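/- Let u₀ satisfy (2.8) and let u be the unique classical solution of the limit problem (2.7). Then for every i = 1,…,k there exist τ_i⁺, τ_i⁻ ∈ [0,∞] (independent of T) such that the one-sided derivative u_x(x_i⁺, t) equals 0 for 0 < t < τ_i⁺ and is nonzero for t > τ_i⁺, and u_x(x_i⁻, t) equals 0 for 0 < t < τ_i⁻ and is nonzero for t > τ_i⁻; moreover the functions t ↦ u_x(x_i⁺, t) and t ↦ u_x(x_i⁻, t) are continuous on (0,T] ∖ {τ_i⁺} and (0,T] ∖ {τ_i⁻} respectively. -/

import Mathlib

open Set Filter MeasureTheory Topology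

/-- Partial derivative in `x` of `u(x,t)`. -/
noncomputable def pdx (u : ℝ → ℝ → ℝ) (x t : ℝ) : ℝ := deriv (fun y => u y t) x

/-- Second partial derivative in `x` of `u(x,t)`. -/
noncomputable def pdxx (u : ℝ → ℝ → ℝ) (x t : ℝ) : ℝ := deriv (fun y => pdx u y t) x

/-- Partial derivative in `t` of `u(x,t)`, one-sided at `t = T`. -/
noncomputable def pdtW (T : ℝ) (u : ℝ → ℝ → ℝ) (x t : ℝ) : ℝ :=
  derivWithin (fun s => u x s) (Set.Iic T) t

/-- `Q = (a,b) × (0,T]`. -/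
def QT (a b T : ℝ) : Set (ℝ × ℝ) := Set.Ioo a b ×ˢ Set.Ioc 0 T

/-- `N = N₀ × [0,T]`. -/
def NSet (N₀ : Set ℝ) (T : ℝ) : Set (ℝ × ℝ) := N₀ ×ˢ Set.Icc 0 T

/-- Condition (2.8): `u₀` is continuous, `u₀(a) = -1`, `u₀(b) = 1`, the zeros of `u₀`
form the finite set `N₀ ⊆ (a,b)`, and `u₀` changes sign at each of its zeros. -/
structure InitData (a b : ℝ) (N₀ : Set ℝ) (u₀ : ℝ → ℝ) : Prop where
  cont : ContinuousOn u₀ (Set.Icc a b)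
  bdry_a : u₀ a = -1
  bdry_b : u₀ b = 1
  fin : N₀.Finite
  sub : N₀ ⊆ Set.Ioo a b
  zeros : ∀ x ∈ Set.Icc a b, (u₀ x = 0 ↔ x ∈ N₀)
  sign_change : ∀ x ∈ N₀, ∀ δ > 0,
    ∃ y ∈ Set.Ioo (x - δ) x, ∃ z ∈ Set.Ioo x (x + δ), u₀ y * u₀ z < 0

/-- A classical solution of the limit problem (2.7): `u ∈ C(Q̄)` vanishing exactly on `N`,
`C^{2,1}` on `Q ∖ N`, with boundary values `∓1`, initial value `u₀`, satisfying
`u_t = |u| u_xx + u(1-|u|)` on `Q ∖ N`. -/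
structure IsClassicalSol (a b T : ℝ) (N₀ : Set ℝ) (u₀ : ℝ → ℝ) (u : ℝ → ℝ → ℝ) : Prop where
  cont : ContinuousOn (fun p : ℝ × ℝ => u p.1 p.2) (Set.Icc a b ×ˢ Set.Icc 0 T)
  zero_iff : ∀ x ∈ Set.Icc a b, ∀ t ∈ Set.Icc 0 T, (u x t = 0 ↔ x ∈ N₀)
  diff_x : ∀ p ∈ QT a b T \ NSet N₀ T, DifferentiableAt ℝ (fun y => u y p.2) p.1
  diff_xx : ∀ p ∈ QT a b T \ NSet N₀ T, DifferentiableAt ℝ (fun y => pdx u y p.2) p.1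
  diff_t : ∀ p ∈ QT a b T \ NSet N₀ T,
    DifferentiableWithinAt ℝ (fun s => u p.1 s) (Set.Iic T) p.2
  cont_x : ContinuousOn (fun p : ℝ × ℝ => pdx u p.1 p.2) (QT a b T \ NSet N₀ T)
  cont_xx : ContinuousOn (fun p : ℝ × ℝ => pdxx u p.1 p.2) (QT a b T \ NSet N₀ T)
  cont_t : ContinuousOn (fun p : ℝ × ℝ => pdtW T u p.1 p.2) (QT a b T \ NSet N₀ T)
  bdry_a : ∀ t ∈ Set.Ioc 0 T, u a t = -1
  bdry_b : ∀ t ∈ Set.Ioc 0 T, u b t = 1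
  init : ∀ x ∈ Set.Ioo a b, u x 0 = u₀ x
  pde : ∀ p ∈ QT a b T \ NSet N₀ T,
    pdtW T u p.1 p.2 = |u p.1 p.2| * pdxx u p.1 p.2 + u p.1 p.2 * (1 - |u p.1 p.2|)

theorem second_deriv_nonneg_of_isLocalMin {f f' : ℝ → ℝ} {x m : ℝ}
    (h : ∀ᶠ y in 𝓝 x, HasDerivAt f (f' y) y) (h2 : HasDerivAt f' m x)
    (hmin : IsLocalMin f x) : 0 ≤ m := by
  by_contra! hm
  have hd : deriv f =ᶠ[𝓝 x] f' := h.mono fun y hy => hy.deriv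
  have hdd : deriv (deriv f) x = m := by rw [hd.deriv_eq, h2.deriv]
  have hmax : IsLocalMax f x := isLocalMax_of_deriv_deriv_neg (by rw [hdd]; exact hm)
    hmin.deriv_eq_zero h.self_of_nhds.continuousAt
  have hconst : f =ᶠ[𝓝 x] fun _ => f x := by
    filter_upwards [hmin, hmax] with y h1 h2 using le_antisymm h2 h1
  have h0 : deriv f =ᶠ[𝓝 x] fun _ => 0 := by
    have := hconst.deriv
    simpa using this
  have : deriv (deriv f) x = 0 := by rw [h0.deriv_eq]; simp
  linarith

theorem deriv_nonpos_of_le_left {f : ℝ → ℝ} {m t : ℝ} (h : HasDerivWithinAt f m (Iic t) t)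
    (hmin : ∀ᶠ s in 𝓝[<] t, f t ≤ f s) : m ≤ 0 := by
  have h1 : HasDerivWithinAt f m (Iio t) t := h.mono Iio_subset_Iic_self
  rw [hasDerivWithinAt_iff_tendsto_slope' (by simp)] at h1
  refine le_of_tendsto h1 ?_
  filter_upwards [hmin, self_mem_nhdsWithin] with s hs hst
  rw [slope_def_field]
  exact div_nonpos_of_nonneg_of_nonpos (by linarith) (by have : s < t := hst; linarith)

theorem deriv_nonneg_of_le_right {f : ℝ → ℝ} {m t : ℝ} (h : HasDerivWithinAt f m (Ici t) t)
    (hmin : ∀ᶠ s in 𝓝[>] t, f t ≤ f s) : 0 ≤ m := by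
  have h1 : HasDerivWithinAt f m (Ioi t) t := h.mono Ioi_subset_Ici_self
  rw [hasDerivWithinAt_iff_tendsto_slope' (by simp)] at h1
  refine ge_of_tendsto h1 ?_
  filter_upwards [hmin, self_mem_nhdsWithin] with s hs hst
  rw [slope_def_field]
  exact div_nonneg (by linarith) (by have : t < s := hst; linarith)

/-- A weak parabolic minimum principle on a rectangle: a function that is nonnegative on the
parabolic boundary and cannot have a negative parabolic minimum is nonnegative. -/
theorem nonneg_of_no_negative_parabolic_min {l s r : ℝ} (hl : 0 < l) (hsr : s ≤ r)
    {z zx zxx zt : ℝ → ℝ → ℝ}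
    (hc : ContinuousOn (fun p : ℝ × ℝ => z p.1 p.2) (Icc 0 l ×ˢ Icc s r))
    (h0 : ∀ t ∈ Icc s r, 0 ≤ z 0 t) (h1 : ∀ t ∈ Icc s r, 0 ≤ z l t)
    (hs : ∀ x ∈ Icc 0 l, 0 ≤ z x s)
    (hx : ∀ x ∈ Ioo 0 l, ∀ t ∈ Ioc s r, HasDerivAt (fun y => z y t) (zx x t) x)
    (hxx : ∀ x ∈ Ioo 0 l, ∀ t ∈ Ioc s r, HasDerivAt (fun y => zx y t) (zxx x t) x)
    (ht : ∀ x ∈ Ioo 0 l, ∀ t ∈ Ioc s r, HasDerivWithinAt (fun q => z x q) (zt x t) (Iic t) t)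
    (hpde : ∀ x ∈ Ioo 0 l, ∀ t ∈ Ioc s r, z x t < 0 → 0 ≤ zxx x t → 0 < zt x t) :
    ∀ x ∈ Icc 0 l, ∀ t ∈ Icc s r, 0 ≤ z x t := by
  obtain ⟨⟨x, t⟩, ⟨hxm, htm⟩, hmin⟩ := (isCompact_Icc.prod isCompact_Icc).exists_isMinOn
    (⟨(0, s), ⟨left_mem_Icc.2 hl.le, left_mem_Icc.2 hsr⟩⟩ : (Icc 0 l ×ˢ Icc s r).Nonempty) hc
  have hmin' : ∀ y ∈ Icc 0 l, ∀ q ∈ Icc s r, z x t ≤ z y q := fun y hy q hq =>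
    hmin (show (y, q) ∈ Icc 0 l ×ˢ Icc s r from ⟨hy, hq⟩)
  simp only at hxm htm
  suffices 0 ≤ z x t from fun y hy q hq => this.trans (hmin' y hy q hq)
  by_contra! hneg
  have hx0 : x ≠ 0 := by rintro rfl; linarith [h0 t htm]
  have hxl : x ≠ l := by rintro rfl; linarith [h1 t htm]
  have hts : t ≠ s := by rintro rfl; linarith [hs x hxm]
  have hxI : x ∈ Ioo 0 l := ⟨lt_of_le_of_ne hxm.1 hx0.symm, lt_of_le_of_ne hxm.2 hxl⟩
  have htI : t ∈ Ioc s r := ⟨lt_of_le_of_ne htm.1 hts.symm, htm.2⟩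
  have hev : ∀ᶠ y in 𝓝 x, y ∈ Ioo 0 l := Ioo_mem_nhds hxI.1 hxI.2
  have hA : 0 ≤ zxx x t := second_deriv_nonneg_of_isLocalMin
    (f := fun y => z y t) (f' := fun y => zx y t)
    (hev.mono fun y hy => hx y hy t htI) (hxx x hxI t htI)
    (hev.mono fun y hy => hmin' y (Ioo_subset_Icc_self hy) t htm)
  have hB : zt x t ≤ 0 := by
    refine deriv_nonpos_of_le_left (ht x hxI t htI) ?_
    filter_upwards [Ioo_mem_nhdsLT htI.1] with q hq
    exact hmin' x hxm q ⟨hq.1.le, hq.2.le.trans htm.2⟩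
  linarith [hpde x hxI t htI hneg hA]

theorem hasDerivAt_integral_of_continuousOn {L s t : ℝ} (hst : s ≤ t) {F F' : ℝ → ℝ → ℝ}
    (hF : ∀ x ∈ Ioo 0 L, ContinuousOn (F x) (Icc s t))
    (hF' : ContinuousOn (fun p : ℝ × ℝ => F' p.1 p.2) (Ioo 0 L ×ˢ Icc s t))
    (hd : ∀ x ∈ Ioo 0 L, ∀ q ∈ Icc s t, HasDerivAt (fun y => F y q) (F' x q) x)
    {x : ℝ} (hx : x ∈ Ioo 0 L) :
    HasDerivAt (fun y => ∫ q in s..t, F y q) (∫ q in s..t, F' x q) x := by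
  obtain ⟨α, hα, hαx⟩ := exists_between hx.1
  obtain ⟨β, hxβ, hβ⟩ := exists_between hx.2
  have hsub : Icc α β ⊆ Ioo 0 L := Icc_subset_Ioo hα hβ
  obtain ⟨C, hC⟩ := (isCompact_Icc.prod isCompact_Icc).exists_bound_of_continuousOn
    (hF'.mono (prod_mono hsub (subset_refl (Icc s t))))
  have hIoc : uIoc s t ⊆ Icc s t := by rw [uIoc_of_le hst]; exact Ioc_subset_Icc_self
  have hmeas : ∀ f : ℝ → ℝ, ContinuousOn f (Icc s t) →
      AEStronglyMeasurable f (volume.restrict (uIoc s t)) := fun f hf =>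
    (hf.mono hIoc).aestronglyMeasurable measurableSet_uIoc
  have hsl : ContinuousOn (F' x) (Icc s t) :=
    hF'.comp (f := fun q => (x, q)) (by fun_prop) fun q hq => ⟨hx, hq⟩
  refine (intervalIntegral.hasDerivAt_integral_of_dominated_loc_of_deriv_le
    (bound := fun _ => C) (Icc_mem_nhds hαx hxβ) ?_ ?_ (hmeas _ hsl) ?_ ?_ ?_).2
  · filter_upwards [Icc_mem_nhds hαx hxβ] with y hy
    exact hmeas _ (hF y (hsub hy))
  · exact (hF x hx).intervalIntegrable_of_Icc hst
  · exact Eventually.of_forall fun q hq y hy => hC (y, q) ⟨hy, hIoc hq⟩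
  · simp
  · exact Eventually.of_forall fun q hq y hy => hd y (hsub hy) q (hIoc hq)

/-- A positive solution of `v_t = v v_xx + v (1 - v)` on `(0,L) × (0,T]`, vanishing at `x = 0`
and equal to a constant `c` at `x = L`, with first and second space derivatives `vx`, `vxx`. -/
structure IsPosSol (L T c : ℝ) (v vx vxx : ℝ → ℝ → ℝ) : Prop where
  L_pos : 0 < L
  T_pos : 0 < T
  cont : Continuous fun p : ℝ × ℝ => v p.1 p.2
  left : ∀ t ∈ Icc 0 T, v 0 t = 0
  right : ∀ t ∈ Icc 0 T, v L t = c
  pos : ∀ x ∈ Ioo 0 L, ∀ t ∈ Icc 0 T, 0 < v x t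
  hasDerivAt_x : ∀ x ∈ Ioo 0 L, ∀ t ∈ Ioc 0 T, HasDerivAt (fun y => v y t) (vx x t) x
  hasDerivAt_xx : ∀ x ∈ Ioo 0 L, ∀ t ∈ Ioc 0 T, HasDerivAt (fun y => vx y t) (vxx x t) x
  hasDerivWithinAt_t : ∀ x ∈ Ioo 0 L, ∀ t ∈ Ioc 0 T,
    HasDerivWithinAt (fun s => v x s) (v x t * (vxx x t + 1 - v x t)) (Iic T) t
  cont_x : ContinuousOn (fun p : ℝ × ℝ => vx p.1 p.2) (Ioo 0 L ×ˢ Ioc 0 T)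
  cont_xx : ContinuousOn (fun p : ℝ × ℝ => vxx p.1 p.2) (Ioo 0 L ×ˢ Ioc 0 T)

namespace IsPosSol

variable {L T c : ℝ} {v vx vxx : ℝ → ℝ → ℝ}

theorem cont_t (h : IsPosSol L T c v vx vxx) (x : ℝ) : Continuous (v x) :=
  h.cont.comp (f := fun q => (x, q)) (by fun_prop)

theorem nonneg (h : IsPosSol L T c v vx vxx) : ∀ x ∈ Icc 0 L, ∀ t ∈ Icc 0 T, 0 ≤ v x t := by
  intro x hx t ht
  have hcl : IsClosed {y : ℝ | 0 ≤ v y t} :=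
    isClosed_le continuous_const (h.cont.comp (f := fun y => (y, t)) (by fun_prop))
  have : closure (Ioo 0 L) ⊆ {y : ℝ | 0 ≤ v y t} :=
    closure_minimal (fun y hy => (h.pos y hy t ht).le) hcl
  rw [closure_Ioo h.L_pos.ne] at this
  exact this hx

theorem c_nonneg (h : IsPosSol L T c v vx vxx) : 0 ≤ c := by
  have := h.nonneg L (right_mem_Icc.2 h.L_pos.le) T (right_mem_Icc.2 h.T_pos.le)
  rwa [h.right T (right_mem_Icc.2 h.T_pos.le)] at this

theorem integral_log (h : IsPosSol L T c v vx vxx) {x s t : ℝ} (hx : x ∈ Ioo 0 L) (hs : 0 < s)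
    (hst : s ≤ t) (ht : t ≤ T) :
    ∫ q in s..t, vxx x q =
      Real.log (v x t) - Real.log (v x s) - (t - s) + ∫ q in s..t, v x q := by
  have hI : Icc s t ⊆ Ioc 0 T := fun q hq => ⟨hs.trans_le hq.1, hq.2.trans ht⟩
  have hv : ∀ q ∈ Icc s t, v x q ≠ 0 := fun q hq =>
    (h.pos x hx q (Ioc_subset_Icc_self (hI hq))).ne'
  have hcxx : ContinuousOn (vxx x) (Icc s t) :=
    h.cont_xx.comp (f := fun q => (x, q)) (by fun_prop) fun q hq => ⟨hx, hI hq⟩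
  have hcv := h.cont_t x
  have i1 : IntervalIntegrable (vxx x) volume s t := hcxx.intervalIntegrable_of_Icc hst
  have i2 : IntervalIntegrable (v x) volume s t := hcv.intervalIntegrable _ _
  have key : ∫ q in s..t, (vxx x q + 1 - v x q) = Real.log (v x t) - Real.log (v x s) := by
    refine intervalIntegral.integral_eq_sub_of_hasDerivAt_of_le (f := fun q => Real.log (v x q))
      hst (hcv.continuousOn.log hv) ?_ ((i1.add (by simp)).sub i2)
    intro q hq
    have hqI := Ioo_subset_Icc_self hq
    have hd := (h.hasDerivWithinAt_t x hx q (hI hqI)).hasDerivAt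
      (Iic_mem_nhds (hq.2.trans_le ht))
    have := hd.log (hv q hqI)
    rwa [mul_div_cancel_left₀ _ (hv q hqI)] at this
  have h2 : ∫ q in s..t, (vxx x q + 1 - v x q) =
      (∫ q in s..t, vxx x q) + (t - s) - ∫ q in s..t, v x q := by
    rw [intervalIntegral.integral_sub (i1.add (by simp)) i2,
      intervalIntegral.integral_add i1 (by simp)]
    simp
  linarith

theorem hasDerivAt_integral_x (h : IsPosSol L T c v vx vxx) {x s t : ℝ} (hx : x ∈ Ioo 0 L)
    (hs : 0 < s) (hst : s ≤ t) (ht : t ≤ T) :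
    HasDerivAt (fun y => ∫ q in s..t, v y q) (∫ q in s..t, vx x q) x := by
  have hI : Icc s t ⊆ Ioc 0 T := fun q hq => ⟨hs.trans_le hq.1, hq.2.trans ht⟩
  exact hasDerivAt_integral_of_continuousOn hst (fun y _ => (h.cont_t y).continuousOn)
    (h.cont_x.mono (prod_mono subset_rfl hI)) (fun y hy q hq => h.hasDerivAt_x y hy q (hI hq)) hx

theorem hasDerivAt_integral_xx (h : IsPosSol L T c v vx vxx) {x s t : ℝ} (hx : x ∈ Ioo 0 L)
    (hs : 0 < s) (hst : s ≤ t) (ht : t ≤ T) :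
    HasDerivAt (fun y => ∫ q in s..t, vx y q)
      (Real.log (v x t) - Real.log (v x s) - (t - s) + ∫ q in s..t, v x q) x := by
  have hI : Icc s t ⊆ Ioc 0 T := fun q hq => ⟨hs.trans_le hq.1, hq.2.trans ht⟩
  rw [← h.integral_log hx hs hst ht]
  exact hasDerivAt_integral_of_continuousOn hst
    (fun y hy => h.cont_x.comp (f := fun q => (y, q)) (by fun_prop) fun q hq => ⟨hy, hI hq⟩)
    (h.cont_xx.mono (prod_mono subset_rfl hI)) (fun y hy q hq => h.hasDerivAt_xx y hy q (hI hq)) hx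

theorem continuous_integral (h : IsPosSol L T c v vx vxx) :
    Continuous fun p : ℝ × ℝ => ∫ q in (0 : ℝ)..p.2, v p.1 q :=
  intervalIntegral.continuous_parametric_intervalIntegral_of_continuous
    (f := fun (p : ℝ × ℝ) q => v p.1 q)
    (h.cont.comp (f := fun p : (ℝ × ℝ) × ℝ => (p.1.1, p.2)) (by fun_prop)) continuous_snd

theorem hasDerivAt_integral_t (h : IsPosSol L T c v vx vxx) (x t : ℝ) :
    HasDerivAt (fun r => ∫ q in (0 : ℝ)..r, v x q) (v x t) t :=
  intervalIntegral.integral_hasDerivAt_right ((h.cont_t x).intervalIntegrable _ _)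
    ((h.cont_t x).stronglyMeasurableAtFilter _ _) (h.cont_t x).continuousAt

theorem integral_sub_integral (h : IsPosSol L T c v vx vxx) (x s t : ℝ) :
    (∫ q in (0 : ℝ)..t, v x q) - ∫ q in (0 : ℝ)..s, v x q = ∫ q in s..t, v x q :=
  intervalIntegral.integral_interval_sub_left ((h.cont_t x).intervalIntegrable _ _)
    ((h.cont_t x).intervalIntegrable _ _)

/-- Comparison, integrated in time, of `v` with the supersolution `(x, t) ↦ k * v x (k * t)`. -/
theorem integral_le_integral_dilate (h : IsPosSol L T c v vx vxx) {k : ℝ} (hk : 1 < k) :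
    ∀ x ∈ Icc 0 L, ∀ s t, 0 ≤ s → s ≤ t → k * t ≤ T →
      ∫ q in s..t, v x q ≤ ∫ q in (k * s)..(k * t), v x q := by
  have hk0 : 0 < k := by linarith
  set P : ℝ → ℝ → ℝ := fun x t => ∫ q in (0 : ℝ)..t, v x q with hP
  have hPc : Continuous fun p : ℝ × ℝ => P p.1 p.2 := h.continuous_integral
  set E : ℝ → ℝ → ℝ → ℝ := fun x s t => P x (k * t) - P x (k * s) - P x t + P x s with hE
  have hEI : ∀ x s t, E x s t = (∫ q in (k * s)..(k * t), v x q) - ∫ q in s..t, v x q := by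
    intro x s t
    rw [← h.integral_sub_integral x (k * s), ← h.integral_sub_integral x s t]
    simp only [hE, hP]; ring
  have hEc : Continuous fun p : ℝ × ℝ × ℝ => E p.1 p.2.1 p.2.2 := by
    have e1 := hPc.comp (f := fun p : ℝ × ℝ × ℝ => (p.1, k * p.2.2)) (by fun_prop)
    have e2 := hPc.comp (f := fun p : ℝ × ℝ × ℝ => (p.1, k * p.2.1)) (by fun_prop)
    have e3 := hPc.comp (f := fun p : ℝ × ℝ × ℝ => (p.1, p.2.2)) (by fun_prop)
    have e4 := hPc.comp (f := fun p : ℝ × ℝ × ℝ => (p.1, p.2.1)) (by fun_prop)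
    exact ((e1.sub e2).sub e3).add e4
  set K : Set (ℝ × ℝ × ℝ) :=
    (Icc 0 L ×ˢ Icc 0 (T / k) ×ˢ Icc 0 (T / k)) ∩ {p | p.2.1 ≤ p.2.2} with hK
  have hKc : IsCompact K := (isCompact_Icc.prod (isCompact_Icc.prod isCompact_Icc)).inter_right
    (isClosed_le (by fun_prop) (by fun_prop))
  have hTk : 0 < T / k := div_pos h.T_pos hk0
  have hKn : K.Nonempty := ⟨(0, 0, 0), by
    simp [hK, h.L_pos.le, hTk.le]⟩
  obtain ⟨⟨x, s, t⟩, ⟨⟨hx, hs, ht⟩, hst⟩, hmin⟩ := hKc.exists_isMinOn hKn hEc.continuousOn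
  have hmin' : ∀ y ∈ Icc 0 L, ∀ p ∈ Icc 0 (T / k), ∀ r ∈ Icc 0 (T / k), p ≤ r →
      E x s t ≤ E y p r := fun y hy p hp r hr hpr =>
    hmin (show (y, p, r) ∈ K from ⟨⟨hy, hp, hr⟩, hpr⟩)
  simp only [mem_ofPred_eq] at hx hs ht hst
  suffices hE0 : 0 ≤ E x s t by
    intro y hy p r hp hpr hr
    have hr' : r ≤ T / k := by rw [le_div_iff₀ hk0]; linarith
    have := hmin' y hy p ⟨hp, hpr.trans hr'⟩ r ⟨hp.trans hpr, hr'⟩ hpr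
    rw [hEI y p r] at this
    linarith
  by_contra! hneg
  have hktT : k * t ≤ T := by have := (le_div_iff₀ hk0).1 ht.2; linarith
  have hconst : ∀ y d : ℝ, ∀ p r : ℝ, 0 ≤ p → p ≤ r → r ≤ T → (∀ q ∈ Icc 0 T, v y q = d) →
      ∫ q in p..r, v y q = d * (r - p) := by
    intro y d p r hp hpr hr hd
    rw [intervalIntegral.integral_congr (g := fun _ => d)]
    · simp [mul_comm]
    · intro q hq
      rw [uIcc_of_le hpr] at hq
      exact hd q ⟨hp.trans hq.1, hq.2.trans hr⟩
  have hbdry : ∀ y d : ℝ, 0 ≤ d → (∀ q ∈ Icc 0 T, v y q = d) → 0 ≤ E y s t := by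
    intro y d hd0 hd
    have htk : t ≤ k * t := by nlinarith [ht.1]
    rw [hEI, hconst y d (k * s) (k * t) (by nlinarith [hs.1]) (by nlinarith) hktT hd,
      hconst y d s t hs.1 hst (by linarith) hd]
    have : 0 ≤ d * ((k - 1) * (t - s)) :=
      mul_nonneg hd0 (mul_nonneg (by linarith) (by linarith))
    linarith
  have hx0 : x ≠ 0 := by rintro rfl; linarith [hbdry 0 0 le_rfl h.left]
  have hxl : x ≠ L := by rintro rfl; linarith [hbdry x c h.c_nonneg h.right]
  have hst' : s ≠ t := by rintro rfl; simp [hE] at hneg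
  have hxI : x ∈ Ioo 0 L := ⟨lt_of_le_of_ne hx.1 hx0.symm, lt_of_le_of_ne hx.2 hxl⟩
  have hlt : s < t := lt_of_le_of_ne hst hst'
  have hP' : ∀ r, HasDerivAt (fun r => P x r) (v x r) r := h.hasDerivAt_integral_t x
  have hPk : ∀ r, HasDerivAt (fun r => P x (k * r)) (k * v x (k * r)) r := fun r => by
    have := (hP' (k * r)).comp r ((hasDerivAt_id r).const_mul k)
    simpa [Function.comp_def, mul_comm] using this
  have hEs : ∀ r, HasDerivAt (fun r => E x r t) (-(k * v x (k * r)) + v x r) r := fun r => by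
    have := (((hasDerivAt_const r (P x (k * t))).sub (hPk r)).sub
      (hasDerivAt_const r (P x t))).add (hP' r)
    exact this.congr_deriv (by ring)
  have hEt : ∀ r, HasDerivAt (fun r => E x s r) (k * v x (k * r) - v x r) r := fun r => by
    have := (((hPk r).sub (hasDerivAt_const r (P x (k * s)))).sub (hP' r)).add
      (hasDerivAt_const r (P x s))
    exact this.congr_deriv (by ring)
  have ht1 : k * v x (k * t) - v x t ≤ 0 := by
    refine deriv_nonpos_of_le_left (hEt t).hasDerivWithinAt ?_
    filter_upwards [Ioo_mem_nhdsLT hlt] with r hr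
    exact hmin' x hx s hs r ⟨hs.1.trans hr.1.le, hr.2.le.trans ht.2⟩ hr.1.le
  have hs1 : 0 ≤ -(k * v x (k * s)) + v x s := by
    refine deriv_nonneg_of_le_right (hEs s).hasDerivWithinAt ?_
    filter_upwards [Ioo_mem_nhdsGT hlt] with r hr
    exact hmin' x hx r ⟨hs.1.trans hr.1.le, hr.2.le.trans ht.2⟩ t ht hr.2.le
  have hs0 : 0 < s := by
    rcases hs.1.lt_or_eq with h0 | h0
    · exact h0
    · subst h0
      have := h.pos x hxI 0 ⟨le_rfl, h.T_pos.le⟩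
      rw [mul_zero] at hs1
      nlinarith
  have hs2 : -(k * v x (k * s)) + v x s ≤ 0 := by
    refine deriv_nonpos_of_le_left (hEs s).hasDerivWithinAt ?_
    filter_upwards [Ioo_mem_nhdsLT hs0] with r hr
    exact hmin' x hx r ⟨hr.1.le, hr.2.le.trans hs.2⟩ t ht (hr.2.le.trans hst)
  have ht0 : 0 < t := hs0.trans hlt
  have hks0 : 0 < k * s := mul_pos hk0 hs0
  have hkst : k * s ≤ k * t := by nlinarith
  have htT : t ≤ T := by nlinarith
  have hxx : 0 ≤ (Real.log (v x (k * t)) - Real.log (v x (k * s)) - (k * t - k * s)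
      + ∫ q in (k * s)..(k * t), v x q) -
      (Real.log (v x t) - Real.log (v x s) - (t - s) + ∫ q in s..t, v x q) := by
    have hev : ∀ᶠ y in 𝓝 x, y ∈ Ioo 0 L := Ioo_mem_nhds hxI.1 hxI.2
    refine second_deriv_nonneg_of_isLocalMin (f := fun y => E y s t)
      (f' := fun y => (∫ q in (k * s)..(k * t), vx y q) - ∫ q in s..t, vx y q) (x := x)
      (hev.mono fun y hy => ?_)
      ((h.hasDerivAt_integral_xx hxI hks0 hkst hktT).sub
        (h.hasDerivAt_integral_xx hxI hs0 hst htT))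
      (hev.mono fun y hy => hmin' y (Ioo_subset_Icc_self hy) s hs t ht hst)
    simp only [hEI]
    exact (h.hasDerivAt_integral_x hy hks0 hkst hktT).sub (h.hasDerivAt_integral_x hy hs0 hst htT)
  rw [hEI] at hneg
  have p1 : 0 < v x (k * t) := h.pos x hxI _ ⟨by nlinarith, hktT⟩
  have p2 : 0 < v x s := h.pos x hxI _ ⟨hs0.le, by linarith⟩
  have l1 : Real.log (k * v x (k * t)) ≤ Real.log (v x t) :=
    Real.log_le_log (mul_pos hk0 p1) (by linarith)
  have p3 : 0 < v x (k * s) := h.pos x hxI _ ⟨hks0.le, by nlinarith⟩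
  have l2 : Real.log (v x s) = Real.log (k * v x (k * s)) := by congr 1; linarith
  rw [Real.log_mul hk0.ne' p1.ne'] at l1
  rw [Real.log_mul hk0.ne' p3.ne'] at l2
  nlinarith

/-- The Aronson–Bénilan type monotonicity: `t ↦ t * v x t` is nondecreasing. -/
theorem time_mul_mono (h : IsPosSol L T c v vx vxx) {x s t : ℝ} (hx : x ∈ Icc 0 L) (hs : 0 < s)
    (hst : s ≤ t) (ht : t ≤ T) : s * v x s ≤ t * v x t := by
  rcases hst.eq_or_lt with rfl | hlt
  · exact le_rfl
  set k := t / s with hk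
  have hk1 : 1 < k := by rw [hk, one_lt_div hs]; exact hlt
  have hks : k * s = t := by rw [hk]; field_simp
  set E : ℝ → ℝ := fun r => ∫ q in (0 : ℝ)..(k * r), v x q with hE
  set F : ℝ → ℝ := fun r => ∫ q in (0 : ℝ)..r, v x q with hF
  have hE' : HasDerivAt E (k * v x (k * s)) s := by
    have := (h.hasDerivAt_integral_t x (k * s)).comp s ((hasDerivAt_id s).const_mul k)
    simpa [hE, Function.comp_def, mul_comm] using this
  have hd : HasDerivAt (fun r => F r - E r) (v x s - k * v x (k * s)) s :=
    (h.hasDerivAt_integral_t x s).sub hE'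
  have hle : v x s - k * v x (k * s) ≤ 0 := by
    refine deriv_nonpos_of_le_left hd.hasDerivWithinAt ?_
    filter_upwards [Ioo_mem_nhdsLT hs] with r hr
    have := h.integral_le_integral_dilate hk1 x hx r s hr.1.le hr.2.le (by rw [hks]; exact ht)
    rw [← h.integral_sub_integral x r s, ← h.integral_sub_integral x (k * r)] at this
    simp only [hE, hF]; linarith
  rw [hks] at hle
  have : s * (v x s - k * v x t) ≤ 0 := mul_nonpos_of_nonneg_of_nonpos hs.le hle
  calc s * v x s ≤ s * (k * v x t) := by linarith
    _ = (k * s) * v x t := by ring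
    _ = t * v x t := by rw [hks]

theorem le_supersolution (h : IsPosSol L T c v vx vxx) {l s r : ℝ} (hl : 0 < l) (hlL : l ≤ L)
    (hs : 0 < s) (hsr : s ≤ r) (hr : r ≤ T) {w wx wxx wt : ℝ → ℝ → ℝ}
    (hc : ContinuousOn (fun p : ℝ × ℝ => w p.1 p.2) (Icc 0 l ×ˢ Icc s r))
    (h0 : ∀ t ∈ Icc s r, 0 ≤ w 0 t) (h1 : ∀ t ∈ Icc s r, v l t ≤ w l t)
    (hi : ∀ x ∈ Icc 0 l, v x s ≤ w x s)
    (hx : ∀ x ∈ Ioo 0 l, ∀ t ∈ Ioc s r, HasDerivAt (fun y => w y t) (wx x t) x)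
    (hxx : ∀ x ∈ Ioo 0 l, ∀ t ∈ Ioc s r, HasDerivAt (fun y => wx y t) (wxx x t) x)
    (ht : ∀ x ∈ Ioo 0 l, ∀ t ∈ Ioc s r, HasDerivAt (fun q => w x q) (wt x t) t)
    (hpde : ∀ x ∈ Ioo 0 l, ∀ t ∈ Ioc s r, w x t < v x t →
      v x t * (wxx x t + 1 - w x t) ≤ wt x t) :
    ∀ x ∈ Icc 0 l, ∀ t ∈ Icc s r, v x t ≤ w x t := by
  have hxL : ∀ x ∈ Ioo 0 l, x ∈ Ioo 0 L := fun x hx => ⟨hx.1, hx.2.trans_le hlL⟩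
  have htT : ∀ t ∈ Ioc s r, t ∈ Ioc 0 T := fun t ht => ⟨hs.trans ht.1, ht.2.trans hr⟩
  have key := nonneg_of_no_negative_parabolic_min (z := fun x t => w x t - v x t)
    (zx := fun x t => wx x t - vx x t) (zxx := fun x t => wxx x t - vxx x t)
    (zt := fun x t => wt x t - v x t * (vxx x t + 1 - v x t)) hl hsr
    (hc.sub h.cont.continuousOn)
    (fun t ht => by
      rw [h.left t ⟨hs.le.trans ht.1, ht.2.trans hr⟩, sub_zero]; exact h0 t ht)
    (fun t ht => sub_nonneg.2 (h1 t ht)) (fun x hx => sub_nonneg.2 (hi x hx))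
    (fun x hx' t ht => (hx x hx' t ht).sub (h.hasDerivAt_x x (hxL x hx') t (htT t ht)))
    (fun x hx' t ht => (hxx x hx' t ht).sub (h.hasDerivAt_xx x (hxL x hx') t (htT t ht)))
    (fun x hx' t ht' => (ht x hx' t ht').hasDerivWithinAt.sub
      ((h.hasDerivWithinAt_t x (hxL x hx') t (htT t ht')).mono (Iic_subset_Iic.2 (htT t ht').2)))
    (fun x hx' t ht' hz hzz => by
      have hp := h.pos x (hxL x hx') t (Ioc_subset_Icc_self (htT t ht'))
      have := hpde x hx' t ht' (by linarith)
      have : v x t * (vxx x t + 1 - v x t) < v x t * (wxx x t + 1 - w x t) :=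
        mul_lt_mul_of_pos_left (by linarith) hp
      linarith)
  exact fun x hx t ht => sub_nonneg.1 (key x hx t ht)

theorem subsolution_le (h : IsPosSol L T c v vx vxx) {l s r : ℝ} (hl : 0 < l) (hlL : l ≤ L)
    (hs : 0 < s) (hsr : s ≤ r) (hr : r ≤ T) {w wx wxx wt : ℝ → ℝ → ℝ}
    (hc : ContinuousOn (fun p : ℝ × ℝ => w p.1 p.2) (Icc 0 l ×ˢ Icc s r))
    (h0 : ∀ t ∈ Icc s r, w 0 t ≤ 0) (h1 : ∀ t ∈ Icc s r, w l t ≤ v l t)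
    (hi : ∀ x ∈ Icc 0 l, w x s ≤ v x s)
    (hx : ∀ x ∈ Ioo 0 l, ∀ t ∈ Ioc s r, HasDerivAt (fun y => w y t) (wx x t) x)
    (hxx : ∀ x ∈ Ioo 0 l, ∀ t ∈ Ioc s r, HasDerivAt (fun y => wx y t) (wxx x t) x)
    (ht : ∀ x ∈ Ioo 0 l, ∀ t ∈ Ioc s r, HasDerivAt (fun q => w x q) (wt x t) t)
    (hpde : ∀ x ∈ Ioo 0 l, ∀ t ∈ Ioc s r, v x t < w x t →
      wt x t ≤ v x t * (wxx x t + 1 - w x t)) :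
    ∀ x ∈ Icc 0 l, ∀ t ∈ Icc s r, w x t ≤ v x t := by
  have hxL : ∀ x ∈ Ioo 0 l, x ∈ Ioo 0 L := fun x hx => ⟨hx.1, hx.2.trans_le hlL⟩
  have htT : ∀ t ∈ Ioc s r, t ∈ Ioc 0 T := fun t ht => ⟨hs.trans ht.1, ht.2.trans hr⟩
  have key := nonneg_of_no_negative_parabolic_min (z := fun x t => v x t - w x t)
    (zx := fun x t => vx x t - wx x t) (zxx := fun x t => vxx x t - wxx x t)
    (zt := fun x t => v x t * (vxx x t + 1 - v x t) - wt x t) hl hsr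
    (h.cont.continuousOn.sub hc)
    (fun t ht => by
      rw [h.left t ⟨hs.le.trans ht.1, ht.2.trans hr⟩, zero_sub]; linarith [h0 t ht])
    (fun t ht => sub_nonneg.2 (h1 t ht)) (fun x hx => sub_nonneg.2 (hi x hx))
    (fun x hx' t ht => (h.hasDerivAt_x x (hxL x hx') t (htT t ht)).sub (hx x hx' t ht))
    (fun x hx' t ht => (h.hasDerivAt_xx x (hxL x hx') t (htT t ht)).sub (hxx x hx' t ht))
    (fun x hx' t ht' => ((h.hasDerivWithinAt_t x (hxL x hx') t (htT t ht')).mono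
      (Iic_subset_Iic.2 (htT t ht').2)).sub (ht x hx' t ht').hasDerivWithinAt)
    (fun x hx' t ht' hz hzz => by
      have hp := h.pos x (hxL x hx') t (Ioc_subset_Icc_self (htT t ht'))
      have := hpde x hx' t ht' (by linarith)
      have : v x t * (wxx x t + 1 - w x t) < v x t * (vxx x t + 1 - v x t) :=
        mul_lt_mul_of_pos_left (by linarith) hp
      linarith)
  exact fun x hx t ht => sub_nonneg.1 (key x hx t ht)

theorem le_parabola (h : IsPosSol L T c v vx vxx) {l s r A : ℝ} (hl : 0 < l) (hlL : l ≤ L)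
    (hs : 0 < s) (hsr : s ≤ r) (hr : r ≤ T) (hA : l ≤ A)
    (h1 : ∀ t ∈ Icc s r, v l t ≤ A * l - l ^ 2 / 2)
    (hi : ∀ x ∈ Icc 0 l, v x s ≤ A * x - x ^ 2 / 2) :
    ∀ x ∈ Icc 0 l, ∀ t ∈ Icc s r, v x t ≤ A * x - x ^ 2 / 2 := by
  refine h.le_supersolution (w := fun x _ => A * x - x ^ 2 / 2) (wx := fun x _ => A - x)
    (wxx := fun _ _ => -1) (wt := fun _ _ => 0) hl hlL hs hsr hr (by fun_prop) (by simp) h1 hi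
    ?_ ?_ ?_ ?_
  · intro x _ t _
    have := ((hasDerivAt_id x).const_mul A).sub (((hasDerivAt_id x).pow 2).div_const 2)
    refine this.congr_deriv ?_
    simp
  · intro x _ t _
    have := (hasDerivAt_const x A).sub (hasDerivAt_id x)
    exact this.congr_deriv (by simp)
  · intro x _ t _
    exact hasDerivAt_const _ _
  · intro x hx t ht _
    have hp := h.pos x ⟨hx.1, hx.2.trans_le hlL⟩ t ⟨hs.le.trans ht.1.le, ht.2.trans hr⟩
    have hw : 0 ≤ A * x - x ^ 2 / 2 := by nlinarith [hx.1, hx.2]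
    nlinarith

/-- An upper bound at a point `y` close to `0`, given a better bound on `[y/2, 3y/2]` shortly
before. -/
theorem le_of_earlier_le (h : IsPosSol L T c v vx vxx) {y s r q C : ℝ} (hy : 0 < y)
    (hyL : 2 * y ≤ L) (hy1 : y ≤ 1) (hs : 0 < s) (hsr : s ≤ r) (hr : r ≤ T)
    (hq : 0 ≤ q) (hC : 0 ≤ C)
    (hCx : ∀ x ∈ Icc 0 (2 * y), ∀ t ∈ Icc s r, v x t ≤ C * x)
    (hi : ∀ x ∈ Icc (y / 2) (3 * y / 2), v x s ≤ q * x) :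
    v y r ≤ q * y + (32 * C ^ 2 + 2 * C) * (r - s) := by
  have key := h.le_supersolution (l := 2 * y)
    (w := fun x t => q * x + 8 * C / y * (x - y) ^ 2 + (32 * C ^ 2 + 2 * C) * (t - s))
    (wx := fun x _ => q + 8 * C / y * (2 * (x - y)))
    (wxx := fun _ _ => 8 * C / y * 2) (wt := fun _ _ => 32 * C ^ 2 + 2 * C)
    (by linarith) hyL hs hsr hr (by fun_prop) ?_ ?_ ?_ ?_ ?_ ?_ ?_ y ⟨hy.le, by linarith⟩ r
    ⟨hsr, le_rfl⟩
  · simpa using key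
  · intro t ht
    have : 0 ≤ t - s := by linarith [ht.1]
    positivity
  · intro t ht
    have h1 : 0 ≤ (32 * C ^ 2 + 2 * C) * (t - s) := by
      have : 0 ≤ t - s := by linarith [ht.1]
      positivity
    have h2 : 8 * C / y * (2 * y - y) ^ 2 = 8 * C * y := by field_simp; ring
    have h3 := hCx (2 * y) ⟨by linarith, le_rfl⟩ t ht
    have h4 : 0 ≤ q * (2 * y) := by positivity
    have h5 : 0 ≤ C * y := by positivity
    linarith
  · intro x hx
    have h1 := hCx x hx s ⟨le_rfl, hsr⟩
    have h2 : 0 ≤ q * x := mul_nonneg hq hx.1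
    have h3 : 0 ≤ 8 * C / y * (x - y) ^ 2 := by positivity
    by_cases hxm : x ∈ Icc (y / 2) (3 * y / 2)
    · have := hi x hxm
      simp only [sub_self, mul_zero, add_zero]; linarith
    · have h4 : y ^ 2 / 4 ≤ (x - y) ^ 2 := by
        by_cases h5 : y / 2 ≤ x
        · have : 3 * y / 2 < x := by by_contra! h6; exact hxm ⟨h5, h6⟩
          nlinarith
        · push Not at h5
          nlinarith
      have h5 : 8 * C / y * (y ^ 2 / 4) ≤ 8 * C / y * (x - y) ^ 2 :=
        mul_le_mul_of_nonneg_left h4 (by positivity)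
      have h6 : 8 * C / y * (y ^ 2 / 4) = C * (2 * y) := by field_simp; ring
      have h7 : C * x ≤ C * (2 * y) := mul_le_mul_of_nonneg_left hx.2 hC
      simp only [sub_self, mul_zero, add_zero]; linarith
  · intro x _ t _
    have := (((hasDerivAt_id x).const_mul q).add
      ((((hasDerivAt_id x).sub_const y).pow 2).const_mul (8 * C / y))).add_const
        ((32 * C ^ 2 + 2 * C) * (t - s))
    refine this.congr_deriv ?_
    simp
  · intro x _ t _
    have := ((((hasDerivAt_id x).sub_const y).const_mul 2).const_mul (8 * C / y)).const_add q
    refine this.congr_deriv ?_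
    simp
  · intro x _ t _
    have := (((hasDerivAt_id t).sub_const s).const_mul (32 * C ^ 2 + 2 * C)).const_add
      (q * x + 8 * C / y * (x - y) ^ 2)
    refine this.congr_deriv ?_
    simp
  · intro x hx t ht _
    have hp := h.pos x ⟨hx.1, hx.2.trans_le hyL⟩ t ⟨hs.le.trans ht.1.le, ht.2.trans hr⟩
    have h1 := hCx x (Ioo_subset_Icc_self hx) t (Ioc_subset_Icc_self ht)
    have h2 : v x t ≤ C * (2 * y) := h1.trans (mul_le_mul_of_nonneg_left hx.2.le hC)
    have hw : 0 ≤ q * x + 8 * C / y * (x - y) ^ 2 + (32 * C ^ 2 + 2 * C) * (t - s) := by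
      have : 0 ≤ t - s := by linarith [ht.1]
      have := hx.1.le
      positivity
    calc v x t * (8 * C / y * 2 + 1 -
          (q * x + 8 * C / y * (x - y) ^ 2 + (32 * C ^ 2 + 2 * C) * (t - s)))
        ≤ v x t * (8 * C / y * 2 + 1) := mul_le_mul_of_nonneg_left (by linarith) hp.le
      _ ≤ C * (2 * y) * (8 * C / y * 2 + 1) := mul_le_mul_of_nonneg_right h2 (by positivity)
      _ = 32 * C ^ 2 + 2 * C * y := by field_simp; ring
      _ ≤ 32 * C ^ 2 + 2 * C := by nlinarith

/-- Propagation of a lower bound from `x = y` to `x = 0`: if `v ≥ q x` on `[0,y]` and `v` is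
noticeably larger at `x = y` for a time of order `y`, then the slope at `0` increases. -/
theorem le_of_lateral_le (h : IsPosSol L T c v vx vxx) {y s k e m A q H : ℝ} (hy : 0 < y)
    (hyL : y ≤ L) (hs : 0 < s) (hk : 0 ≤ k) (hsT : s + k * y ≤ T) (he : 0 < e) (hm : 0 < m)
    (hemk : e * m * k < 1) (hH : H = m / (1 - e * m * k)) (hA : 0 ≤ A) (heq : e ≤ q)
    (hq : ∀ x ∈ Icc 0 y, ∀ t ∈ Icc s (s + k * y), q * x ≤ v x t)
    (hlat : ∀ t ∈ Icc s (s + k * y), (q + A * (H * Real.exp H)) * y ≤ v y t)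
    (hone : (q + A * (H * Real.exp H)) * y ≤ 1) :
    ∀ x ∈ Icc 0 y, x * (q + A * (H - m * Real.exp m)) ≤ v x (s + k * y) := by
  set d : ℝ → ℝ := fun t => 1 - e * m * ((t - s) / y) with hd
  set η : ℝ → ℝ := fun t => m / d t with hη
  have hτ : ∀ t ∈ Icc s (s + k * y), (t - s) / y ∈ Icc 0 k := fun t ht =>
    ⟨div_nonneg (by linarith [ht.1]) hy.le, by rw [div_le_iff₀ hy]; linarith [ht.2]⟩
  have hem : 0 < e * m := mul_pos he hm
  have hdpos : ∀ t ∈ Icc s (s + k * y), 0 < d t := fun t ht => by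
    have := mul_le_mul_of_nonneg_left (hτ t ht).2 hem.le
    simp only [hd]; linarith
  have hηpos : ∀ t ∈ Icc s (s + k * y), 0 < η t := fun t ht => div_pos hm (hdpos t ht)
  have hηH : ∀ t ∈ Icc s (s + k * y), η t ≤ H := fun t ht => by
    have := mul_le_mul_of_nonneg_left (hτ t ht).2 hem.le
    rw [hH]
    exact div_le_div_of_nonneg_left hm.le (by linarith) (by simp only [hd]; linarith)
  have hηs : η s = m := by simp [hη, hd]
  have hηe : η (s + k * y) = H := by
    simp only [hη, hd, hH]
    congr 3
    field_simp
    ring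
  have hky : 0 ≤ k * y := mul_nonneg hk hy.le
  have hH0 : 0 < H := by rw [← hηe]; exact hηpos _ ⟨by linarith, le_rfl⟩
  have hηd : ∀ t ∈ Icc s (s + k * y), HasDerivAt η (e * η t ^ 2 / y) t := fun t ht => by
    have h1 : HasDerivAt d (-(e * m * (1 / y))) t := by
      have := ((((hasDerivAt_id t).sub_const s).div_const y).const_mul (e * m)).const_sub 1
      exact this
    have h2 := (hasDerivAt_const t m).div h1 (hdpos t ht).ne'
    refine h2.congr_deriv ?_
    have := (hdpos t ht).ne'
    simp only [hη]
    field_simp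
    ring
  set w : ℝ → ℝ → ℝ := fun x t =>
    x * (q + A * (η t * Real.exp (η t * (x / y)) - m * Real.exp m)) with hw
  have hψ : ∀ x ∈ Icc 0 y, ∀ t ∈ Icc s (s + k * y),
      η t * Real.exp (η t * (x / y)) ≤ H * Real.exp H := fun x hx t ht => by
    have h1 : x / y ≤ 1 := (div_le_one hy).2 hx.2
    have h2 : 0 ≤ x / y := div_nonneg hx.1 hy.le
    have h3 : η t * (x / y) ≤ H :=
      (mul_le_of_le_one_right (hηpos t ht).le h1).trans (hηH t ht)
    exact mul_le_mul (hηH t ht) (Real.exp_le_exp.2 h3) (Real.exp_pos _).le hH0.le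
  have hmexp : 0 < m * Real.exp m := mul_pos hm (Real.exp_pos _)
  have hwle : ∀ x ∈ Icc 0 y, ∀ t ∈ Icc s (s + k * y),
      w x t ≤ x * (q + A * (H * Real.exp H)) := fun x hx t ht => by
    refine mul_le_mul_of_nonneg_left ?_ hx.1
    have : A * (η t * Real.exp (η t * (x / y)) - m * Real.exp m) ≤ A * (H * Real.exp H) :=
      mul_le_mul_of_nonneg_left (by linarith [hψ x hx t ht]) hA
    linarith
  have hdη : ContinuousOn η (Icc s (s + k * y)) := fun t ht =>
    (hηd t ht).continuousAt.continuousWithinAt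
  have hcont : ContinuousOn (fun p : ℝ × ℝ => w p.1 p.2) (Icc 0 y ×ˢ Icc s (s + k * y)) := by
    have h2 : ContinuousOn (fun p : ℝ × ℝ => η p.2) (Icc 0 y ×ˢ Icc s (s + k * y)) :=
      hdη.comp (by fun_prop) fun p hp => hp.2
    have h3 : ContinuousOn (fun p : ℝ × ℝ => Real.exp (η p.2 * (p.1 / y)))
        (Icc 0 y ×ˢ Icc s (s + k * y)) :=
      (h2.mul (continuousOn_fst.div_const y)).rexp
    exact continuousOn_fst.mul (continuousOn_const.add
      (continuousOn_const.mul ((h2.mul h3).sub continuousOn_const)))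
  have key := h.subsolution_le (w := w)
    (wx := fun x t => q + A * (η t * Real.exp (η t * (x / y)) - m * Real.exp m) +
      x * (A * (η t * (Real.exp (η t * (x / y)) * (η t * (1 / y))))))
    (wxx := fun x t => A * η t ^ 2 / y * (2 + η t * (x / y)) * Real.exp (η t * (x / y)))
    (wt := fun x t => x * (A * (e * η t ^ 2 / y * (1 + η t * (x / y)) *
      Real.exp (η t * (x / y))))) hy hyL hs (by linarith) hsT hcont ?_ ?_ ?_ ?_ ?_ ?_ ?_
  · intro x hx
    refine le_trans ?_ (key x hx (s + k * y) ⟨by linarith, le_rfl⟩)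
    simp only [hw, hηe]
    refine mul_le_mul_of_nonneg_left ?_ hx.1
    have h1 : 1 ≤ Real.exp (H * (x / y)) :=
      Real.one_le_exp (mul_nonneg hH0.le (div_nonneg hx.1 hy.le))
    have h2 : H ≤ H * Real.exp (H * (x / y)) := le_mul_of_one_le_right hH0.le h1
    have := mul_le_mul_of_nonneg_left
      (show H - m * Real.exp m ≤ H * Real.exp (H * (x / y)) - m * Real.exp m by linarith) hA
    linarith
  · intro t _
    simp [hw]
  · intro t ht
    refine (hwle y ⟨hy.le, le_rfl⟩ t ht).trans ?_
    rw [mul_comm]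
    exact hlat t ht
  · intro x hx
    refine le_trans ?_ (hq x hx s ⟨le_rfl, by linarith⟩)
    simp only [hw, hηs]
    rw [mul_comm q]
    refine mul_le_mul_of_nonneg_left ?_ hx.1
    have h1 : m * (x / y) ≤ m := mul_le_of_le_one_right hm.le ((div_le_one hy).2 hx.2)
    have h2 : m * Real.exp (m * (x / y)) ≤ m * Real.exp m :=
      mul_le_mul_of_nonneg_left (Real.exp_le_exp.2 h1) hm.le
    have := mul_nonneg hA (sub_nonneg.2 h2)
    linarith
  · intro x _ t _
    have he1 := ((((hasDerivAt_id x).div_const y).const_mul (η t)).exp).const_mul (η t)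
    have he2 := (hasDerivAt_id x).mul (((he1.sub_const (m * Real.exp m)).const_mul A).const_add q)
    refine he2.congr_deriv ?_
    simp
  · intro x _ t _
    have he1 := (((hasDerivAt_id x).div_const y).const_mul (η t)).exp
    have he2 := (((he1.const_mul (η t)).sub_const (m * Real.exp m)).const_mul A).const_add q
    have he3 := (hasDerivAt_id x).mul
      (((he1.mul_const (η t * (1 / y))).const_mul (η t)).const_mul A)
    refine (he2.add he3).congr_deriv ?_
    simp only [id]
    field_simp
    ring
  · intro x _ t ht
    have hη' := hηd t (Ioc_subset_Icc_self ht)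
    have he1 := (hη'.mul_const (x / y)).exp
    have he2 := ((((hη'.mul he1).sub_const (m * Real.exp m)).const_mul A).const_add q).const_mul x
    refine he2.congr_deriv ?_
    field_simp
  · intro x hx t ht _
    have hxI := Ioo_subset_Icc_self hx
    have htI := Ioc_subset_Icc_self ht
    have hvx : e * x ≤ v x t :=
      (mul_le_mul_of_nonneg_right heq hx.1.le).trans (hq x hxI t htI)
    have hxx0 : 0 ≤ A * η t ^ 2 / y * (2 + η t * (x / y)) * Real.exp (η t * (x / y)) := by
      have := (hηpos t htI).le
      have := hx.1.le
      positivity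
    have hw1 : w x t ≤ 1 := by
      refine (hwle x hxI t htI).trans (le_trans ?_ hone)
      rw [mul_comm]
      have hq0 : 0 ≤ q + A * (H * Real.exp H) := by
        have : 0 ≤ A * (H * Real.exp H) := by positivity
        linarith
      exact mul_le_mul_of_nonneg_left hx.2.le hq0
    have hv0 : 0 ≤ v x t := le_trans (mul_nonneg he.le hx.1.le) hvx
    calc x * (A * (e * η t ^ 2 / y * (1 + η t * (x / y)) * Real.exp (η t * (x / y))))
        ≤ x * (A * (e * η t ^ 2 / y * (2 + η t * (x / y)) * Real.exp (η t * (x / y)))) := by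
          have := (hηpos t htI).le
          have := hx.1.le
          gcongr
          norm_num
      _ = e * x * (A * η t ^ 2 / y * (2 + η t * (x / y)) * Real.exp (η t * (x / y))) := by ring
      _ ≤ v x t * (A * η t ^ 2 / y * (2 + η t * (x / y)) * Real.exp (η t * (x / y))) :=
          mul_le_mul_of_nonneg_right hvx hxx0
      _ ≤ _ := mul_le_mul_of_nonneg_left (by linarith) hv0

theorem eventually_slope_bounds {t p ε : ℝ} (h0 : v 0 t = 0)
    (hg : Tendsto (fun x => v x t / x) (𝓝[>] 0) (𝓝 p)) (hε : 0 < ε) :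
    ∀ᶠ δ in 𝓝[>] (0 : ℝ), ∀ x ∈ Icc 0 δ, (p - ε) * x ≤ v x t ∧ v x t ≤ (p + ε) * x := by
  have h1 := hg.eventually (Ioo_mem_nhds (show p - ε < p by linarith) (show p < p + ε by linarith))
  obtain ⟨δ, hδ, hsub⟩ := (mem_nhdsGT_iff_exists_Ioo_subset).1 h1
  filter_upwards [Ioo_mem_nhdsGT hδ] with y hy x hx
  rcases hx.1.eq_or_lt with rfl | hx0
  · simp [h0]
  · have h2 : v x t / x ∈ Ioo (p - ε) (p + ε) := hsub ⟨hx0, hx.2.trans_lt hy.2⟩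
    exact ⟨((lt_div_iff₀ hx0).1 h2.1).le, ((div_lt_iff₀ hx0).1 h2.2).le⟩

theorem le_slope {t p m δ : ℝ} (hg : Tendsto (fun x => v x t / x) (𝓝[>] 0) (𝓝 p)) (hδ : 0 < δ)
    (hm : ∀ x ∈ Icc 0 δ, m * x ≤ v x t) : m ≤ p := by
  refine ge_of_tendsto hg ?_
  filter_upwards [Ioo_mem_nhdsGT hδ] with x hx
  exact (le_div_iff₀ hx.1).2 (hm x (Ioo_subset_Icc_self hx))

theorem slope_le {t p m δ : ℝ} (hg : Tendsto (fun x => v x t / x) (𝓝[>] 0) (𝓝 p)) (hδ : 0 < δ)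
    (hm : ∀ x ∈ Icc 0 δ, v x t ≤ m * x) : p ≤ m := by
  refine le_of_tendsto hg ?_
  filter_upwards [Ioo_mem_nhdsGT hδ] with x hx
  exact (div_le_iff₀ hx.1).2 (hm x (Ioo_subset_Icc_self hx))

variable {g : ℝ → ℝ}

theorem slope_nonneg (h : IsPosSol L T c v vx vxx)
    (hg : ∀ t ∈ Ioc 0 T, Tendsto (fun x => v x t / x) (𝓝[>] 0) (𝓝 (g t))) {t : ℝ}
    (ht : t ∈ Ioc 0 T) : 0 ≤ g t :=
  le_slope (hg t ht) h.L_pos fun x hx => by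
    rw [zero_mul]; exact h.nonneg x hx t (Ioc_subset_Icc_self ht)

theorem time_mul_slope_mono (h : IsPosSol L T c v vx vxx)
    (hg : ∀ t ∈ Ioc 0 T, Tendsto (fun x => v x t / x) (𝓝[>] 0) (𝓝 (g t))) {s t : ℝ}
    (hs : 0 < s) (hst : s ≤ t) (ht : t ≤ T) : s * g s ≤ t * g t := by
  refine le_of_tendsto_of_tendsto ((hg s ⟨hs, hst.trans ht⟩).const_mul s)
    ((hg t ⟨hs.trans_le hst, ht⟩).const_mul t) ?_
  filter_upwards [Ioo_mem_nhdsGT h.L_pos] with x hx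
  rw [← mul_div_assoc, ← mul_div_assoc]
  exact div_le_div_of_nonneg_right (h.time_mul_mono (Ioo_subset_Icc_self hx) hs hst ht) hx.1.le

theorem slope_upper_right (h : IsPosSol L T c v vx vxx)
    (hg : ∀ t ∈ Ioc 0 T, Tendsto (fun x => v x t / x) (𝓝[>] 0) (𝓝 (g t))) {t₀ ε : ℝ}
    (ht₀ : t₀ ∈ Ioc 0 T) (hε : 0 < ε) :
    ∃ η > 0, ∀ t ∈ Icc t₀ (t₀ + η), t ≤ T → g t ≤ g t₀ + ε := by
  have hg0 := h.slope_nonneg hg ht₀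
  have e1 := eventually_slope_bounds (h.left t₀ (Ioc_subset_Icc_self ht₀)) (hg t₀ ht₀)
    (half_pos hε)
  obtain ⟨δ, hδb, hδ⟩ := (e1.and (Ioo_mem_nhdsGT (lt_min h.L_pos (half_pos hε)))).exists
  have hδL : δ < L := hδ.2.trans_le (min_le_left _ _)
  have hδε : δ < ε / 2 := hδ.2.trans_le (min_le_right _ _)
  have hδ0 : 0 < δ := hδ.1
  have hlt : v δ t₀ < (g t₀ + ε) * δ - δ ^ 2 / 2 := by
    have := (hδb δ ⟨hδ0.le, le_rfl⟩).2
    nlinarith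
  obtain ⟨η, hη, hηs⟩ := (Metric.eventually_nhds_iff).1
    ((h.cont_t δ).continuousAt.eventually (gt_mem_nhds hlt))
  refine ⟨η / 2, half_pos hη, fun t ht htT => ?_⟩
  have key := h.le_parabola hδ0 hδL.le ht₀.1 ht.1 htT (A := g t₀ + ε) (by linarith)
    (fun r hr => (hηs (by
      rw [Real.dist_eq, abs_lt]
      constructor <;> linarith [hr.1, hr.2, ht.2])).le)
    (fun x hx => by
      have := (hδb x hx).2
      nlinarith [hx.1, hx.2])
  refine slope_le (hg t ⟨ht₀.1.trans_le ht.1, htT⟩) hδ0 fun x hx => ?_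
  have := key x hx t ⟨ht.1, le_rfl⟩
  nlinarith [sq_nonneg x]

/-- Parameters for the subsolution used in `le_of_lateral_le`. -/
theorem exists_subsolution_params {e k ε : ℝ} (he : 0 < e) (hk : 0 < k) (hε : 0 < ε) :
    ∃ m A H : ℝ, 0 < m ∧ e * m * k < 1 ∧ H = m / (1 - e * m * k) ∧ 0 ≤ A ∧
      A * (H * Real.exp H) = ε ∧ 0 < A * (H - m * Real.exp m) := by
  have hek : 0 < e * k := mul_pos he hk
  set μ : ℝ := Real.exp (-(1 / (e * k))) / 2 with hμ
  have hμ0 : 0 < μ := half_pos (Real.exp_pos _)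
  have hμ1 : μ < 1 := by
    have : Real.exp (-(1 / (e * k))) ≤ 1 := Real.exp_le_one_iff.2 (by
      have : 0 < 1 / (e * k) := by positivity
      linarith)
    linarith
  set m : ℝ := (1 - μ) / (e * k) with hm
  have hm0 : 0 < m := div_pos (by linarith) hek
  have hemk : e * m * k = 1 - μ := by rw [hm]; field_simp
  set H : ℝ := m / μ with hH
  have hH0 : 0 < H := div_pos hm0 hμ0
  have hHe : 0 < H * Real.exp H := mul_pos hH0 (Real.exp_pos _)
  refine ⟨m, ε / (H * Real.exp H), H, hm0, by linarith, by rw [hemk]; simp [hH],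
    (div_pos hε hHe).le, by field_simp, mul_pos (div_pos hε hHe) (sub_pos.2 ?_)⟩
  have h1 : m < 1 / (e * k) := div_lt_div_of_pos_right (by linarith) hek
  have h2 : Real.exp m < Real.exp (1 / (e * k)) := Real.exp_lt_exp.2 h1
  have h3 : H = m * (2 * Real.exp (1 / (e * k))) := by
    rw [hH, hμ, Real.exp_neg]; field_simp
  rw [h3]
  have := Real.exp_pos m
  exact mul_lt_mul_of_pos_left (by linarith) hm0

set_option maxHeartbeats 1000000 in
theorem slope_lower_left (h : IsPosSol L T c v vx vxx)
    (hg : ∀ t ∈ Ioc 0 T, Tendsto (fun x => v x t / x) (𝓝[>] 0) (𝓝 (g t))) {t₀ : ℝ}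
    (ht₀ : t₀ ∈ Ioc 0 T) (hpos : ∃ t ∈ Ioo 0 t₀, 0 < g t) {m : ℝ} (hm : m < g t₀) :
    ∃ t ∈ Ioo 0 t₀, t₀ * m < t * g t := by
  by_contra! hcon
  have ht0 := ht₀.1
  have hIoo : ∀ t ∈ Ioo 0 t₀, t ∈ Ioc 0 T := fun t ht => ⟨ht.1, ht.2.le.trans ht₀.2⟩
  set S : Set ℝ := (fun t => t * g t) '' Ioo 0 t₀ with hS
  have hSb : BddAbove S := ⟨t₀ * m, by rintro _ ⟨t, ht, rfl⟩; exact hcon t ht⟩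
  obtain ⟨t', ht', hgt'⟩ := hpos
  have hSn : S.Nonempty := ⟨_, t', ht', rfl⟩
  obtain ⟨q, hq⟩ : ∃ q, t₀ * q = sSup S := ⟨sSup S / t₀, by field_simp⟩
  have hqub : ∀ t ∈ Ioo 0 t₀, t * g t ≤ t₀ * q := fun t ht => by
    rw [hq]; exact le_csSup hSb ⟨t, ht, rfl⟩
  have hq0 : 0 < q := by
    have h1 := hqub t' ht'
    have h2 : 0 < t' * g t' := mul_pos ht'.1 hgt'
    exact pos_of_mul_pos_right (h2.trans_le h1) ht0.le
  have hqm : q ≤ m := by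
    have : t₀ * q ≤ t₀ * m := by
      rw [hq]; exact csSup_le hSn (by rintro _ ⟨t, ht, rfl⟩; exact hcon t ht)
    exact le_of_mul_le_mul_left this ht0
  obtain ⟨p, hp⟩ : ∃ p, p = g t₀ := ⟨_, rfl⟩
  have hqp : q < p := by linarith
  obtain ⟨ε, hε⟩ : ∃ ε, ε = (p - q) / 8 := ⟨_, rfl⟩
  have hε0 : 0 < ε := by linarith
  obtain ⟨C, hC⟩ : ∃ C, C = 2 * (p + 1) := ⟨_, rfl⟩
  have hC0 : 0 < C := by linarith
  obtain ⟨K, hK⟩ : ∃ K, K = 32 * C ^ 2 + 2 * C := ⟨_, rfl⟩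
  have hK0 : 0 < K := by rw [hK]; positivity
  obtain ⟨k, hk⟩ : ∃ k, k = ε / (2 * K) := ⟨_, rfl⟩
  have hk0 : 0 < k := by rw [hk]; positivity
  have hKk : K * (2 * k) = ε := by rw [hk]; field_simp
  obtain ⟨n, A, H, hn, hnk, hH, hA, hAH, hθ⟩ := exists_subsolution_params (half_pos hq0) hk0 hε0
  obtain ⟨θ, hθe⟩ : ∃ θ, θ = A * (H - n * Real.exp n) := ⟨_, rfl⟩
  rw [← hθe] at hθ
  obtain ⟨η, hη⟩ : ∃ η, η = min (θ / 4) (q / 2) := ⟨_, rfl⟩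
  have hη0 : 0 < η := by rw [hη]; exact lt_min (by linarith) (by linarith)
  have hηθ : η ≤ θ / 4 := by rw [hη]; exact min_le_left _ _
  have hηq : η ≤ q / 2 := by rw [hη]; exact min_le_right _ _
  obtain ⟨_, ⟨t₁, ht₁, rfl⟩, ht₁q⟩ := exists_lt_of_lt_csSup hSn
    (show t₀ * (q - η / 2) < sSup S by rw [← hq]; exact mul_lt_mul_of_pos_left (by linarith) ht0)
  simp only at ht₁q
  have ev1 := eventually_slope_bounds (h.left t₁ (Ioc_subset_Icc_self (hIoo t₁ ht₁)))
    (hg t₁ (hIoo t₁ ht₁)) (half_pos hη0)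
  have ev2 := eventually_slope_bounds (h.left t₀ (Ioc_subset_Icc_self ht₀)) (hg t₀ ht₀)
    (lt_min hε0 one_pos)
  have htend2 : Tendsto (fun y : ℝ => 2 * y) (𝓝[>] 0) (𝓝[>] 0) := by
    refine tendsto_nhdsWithin_iff.2 ⟨?_, ?_⟩
    · have : Tendsto (fun y : ℝ => 2 * y) (𝓝 0) (𝓝 (2 * 0)) := (by fun_prop : Continuous
        fun y : ℝ => 2 * y).tendsto 0
      rw [mul_zero] at this
      exact this.mono_left nhdsWithin_le_nhds
    · filter_upwards [self_mem_nhdsWithin] with y hy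
      have : (0 : ℝ) < y := hy
      exact mem_Ioi.2 (by linarith)
  have hsm : ∀ f : ℝ → ℝ, Continuous f → 0 < f 0 → ∀ᶠ y in 𝓝[>] (0 : ℝ), 0 < f y :=
    fun f hf h0 => nhdsWithin_le_nhds (hf.continuousAt.eventually (lt_mem_nhds h0))
  have ev3 := hsm (fun y => L - 2 * y) (by fun_prop) (by simpa using h.L_pos)
  have ev4 := hsm (fun y => 1 - y) (by fun_prop) (by simp)
  have ev5 := hsm (fun y => t₀ - 2 * k * y - t₀ / 2) (by fun_prop) (by linarith)
  have ev6 := hsm (fun y => t₀ - 2 * k * y - t₁) (by fun_prop) (by linarith [ht₁.2])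
  have ev7 := hsm (fun y => (t₀ - 2 * k * y) * (q + 2 * ε) - t₀ * (q + ε)) (by fun_prop)
    (by nlinarith)
  have ev8 := hsm (fun y => 1 - (q + ε) * (2 * y)) (by fun_prop) (by simp)
  have ev9 := hsm (fun y => (t₀ - 2 * k * y) * (q - η + θ) - t₀ * q) (by fun_prop)
    (by nlinarith)
  obtain ⟨y, ⟨⟨⟨hb1, hb2⟩, h3, h4⟩, ⟨h5, h6⟩, h7⟩, ⟨h8, h9⟩, hy⟩ :=
    ((((((htend2.eventually ev1).and (htend2.eventually ev2)).and (ev3.and ev4)).and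
      ((ev5.and ev6).and ev7)).and ((ev8.and ev9).and self_mem_nhdsWithin))).exists
  have hy0 : 0 < y := hy
  clear ev1 ev2 ev3 ev4 ev5 ev6 ev7 ev8 ev9 htend2 hsm
  obtain ⟨s, hs⟩ : ∃ s, s = t₀ - 2 * k * y := ⟨_, rfl⟩
  rw [← hs] at h5 h6 h7 h9
  have hs0 : 0 < s := by linarith
  have hky : 0 < k * y := mul_pos hk0 hy0
  have hst₀ : s ≤ t₀ := by linarith
  have hxL : ∀ x ∈ Icc 0 (2 * y), x ∈ Icc 0 L := fun x hx => ⟨hx.1, by linarith [hx.2]⟩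
  have hlow : ∀ x ∈ Icc 0 (2 * y), ∀ t ∈ Icc s t₀, (q - η) * x ≤ v x t := fun x hx t ht => by
    have a1 := h.time_mul_mono (hxL x hx) ht₁.1 (by linarith [ht.1] : t₁ ≤ t)
      (ht.2.trans ht₀.2)
    have a2 := mul_le_mul_of_nonneg_left (hb1 x hx).1 ht₁.1.le
    have ht0' : 0 < t := hs0.trans_le ht.1
    have a3 : t₀ * (q - η) ≤ t₁ * (g t₁ - η / 2) := by nlinarith [ht₁.2]
    have a4 : t * (q - η) ≤ t₀ * (q - η) := mul_le_mul_of_nonneg_right ht.2 (by linarith)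
    have a5 := mul_le_mul_of_nonneg_right (a4.trans a3) hx.1
    refine le_of_mul_le_mul_left (a := t) ?_ ht0'
    linarith
  have hup : ∀ x ∈ Icc 0 (2 * y), ∀ t ∈ Icc s t₀, v x t ≤ C * x := fun x hx t ht => by
    have a1 := h.time_mul_mono (hxL x hx) (hs0.trans_le ht.1) ht.2 ht₀.2
    have a2 : v x t₀ ≤ (p + 1) * x := by
      refine (hb2 x hx).2.trans (mul_le_mul_of_nonneg_right ?_ hx.1)
      rw [hp]; linarith [min_le_right ε 1]
    have hvn := h.nonneg x (hxL x hx) t ⟨hs0.le.trans ht.1, ht.2.trans ht₀.2⟩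
    have a3 : t₀ / 2 * v x t ≤ t * v x t := mul_le_mul_of_nonneg_right (by linarith [ht.1]) hvn
    have a4 := mul_le_mul_of_nonneg_left a2 ht0.le
    refine le_of_mul_le_mul_left (a := t₀ / 2) ?_ (by linarith)
    rw [hC]; linarith
  obtain ⟨Y, hY, hYv⟩ : ∃ x ∈ Icc (y / 2) (3 * y / 2), (q + 2 * ε) * x < v x s := by
    by_contra! hno
    have a1 := h.le_of_earlier_le (q := q + 2 * ε) hy0 (by linarith) (by linarith) hs0 hst₀ ht₀.2
      (by linarith) hC0.le hup hno
    have a2 := (hb2 y ⟨hy0.le, by linarith⟩).1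
    have a3 : (p - ε) * y ≤ v y t₀ := by
      refine le_trans (mul_le_mul_of_nonneg_right ?_ hy0.le) a2
      rw [hp]; linarith [min_le_left ε 1]
    rw [← hK] at a1
    have a4 : K * (t₀ - s) = ε * y := by rw [← hKk, hs]; ring
    have a5 : (p - ε) * y ≤ (q + 3 * ε) * y := by linarith
    have := le_of_mul_le_mul_right a5 hy0
    linarith
  have hY0 : 0 < Y := by linarith [hY.1]
  have hY2 : Y ≤ 2 * y := by linarith [hY.2]
  have hYI : ∀ x ∈ Icc 0 Y, x ∈ Icc 0 (2 * y) := fun x hx => ⟨hx.1, hx.2.trans hY2⟩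
  have hskY : s + k * Y < t₀ := by
    have : k * Y ≤ k * (3 * y / 2) := mul_le_mul_of_nonneg_left hY.2 hk0.le
    linarith
  have hkY : 0 < k * Y := mul_pos hk0 hY0
  have hfin := h.le_of_lateral_le (q := q - η) hY0 (by linarith) hs0 hk0.le
    (by linarith [ht₀.2]) (half_pos hq0) hn hnk hH hA (by linarith)
    (fun x hx t ht => hlow x (hYI x hx) t ⟨ht.1, by linarith [ht.2]⟩)
    (fun t ht => by
      have htt : t ≤ t₀ := by linarith [ht.2]
      have a1 := h.time_mul_mono (hxL Y ⟨hY0.le, hY2⟩) hs0 ht.1 (htt.trans ht₀.2)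
      have a2 := mul_le_mul_of_nonneg_left hYv.le hs0.le
      have a3 : t * (q - η + ε) ≤ s * (q + 2 * ε) := by
        have : t * (q - η + ε) ≤ t₀ * (q - η + ε) :=
          mul_le_mul_of_nonneg_right htt (by linarith)
        nlinarith
      have a4 := mul_le_mul_of_nonneg_right a3 hY0.le
      rw [hAH]
      refine le_of_mul_le_mul_left (a := t) ?_ (hs0.trans_le ht.1)
      linarith)
    (by
      rw [hAH]
      have : (q - η + ε) * Y ≤ (q + ε) * (2 * y) :=
        mul_le_mul (by linarith) hY2 hY0.le (by linarith)
      linarith)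
  rw [← hθe] at hfin
  have hI : s + k * Y ∈ Ioo 0 t₀ := ⟨by linarith, hskY⟩
  have hge : q - η + θ ≤ g (s + k * Y) :=
    le_slope (hg _ (hIoo _ hI)) hY0 fun x hx => by rw [mul_comm]; exact hfin x hx
  have b1 := hqub _ hI
  have b2 : (s + k * Y) * (q - η + θ) ≤ (s + k * Y) * g (s + k * Y) :=
    mul_le_mul_of_nonneg_left hge hI.1.le
  have b3 : s * (q - η + θ) ≤ (s + k * Y) * (q - η + θ) :=
    mul_le_mul_of_nonneg_right (by linarith) (by linarith)
  linarith

theorem exists_waiting_time (h : IsPosSol L T c v vx vxx)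
    (hg : ∀ t ∈ Ioc 0 T, Tendsto (fun x => v x t / x) (𝓝[>] 0) (𝓝 (g t))) :
    ∃ τ : ENNReal,
      (∀ t ∈ Ioc (0 : ℝ) T,
        (ENNReal.ofReal t < τ → g t = 0) ∧ (τ < ENNReal.ofReal t → g t ≠ 0)) ∧
      ContinuousOn g {s : ℝ | s ∈ Ioc (0 : ℝ) T ∧ ENNReal.ofReal s ≠ τ} := by
  set τ : ENNReal := sInf (ENNReal.ofReal '' {t | t ∈ Ioc 0 T ∧ g t ≠ 0}) with hτ
  have hlt : ∀ t ∈ Ioc (0 : ℝ) T, ENNReal.ofReal t < τ → g t = 0 := fun t ht htτ => by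
    by_contra hne
    have hle : τ ≤ ENNReal.ofReal t := sInf_le ⟨t, ⟨ht, hne⟩, rfl⟩
    exact absurd hle (not_le.2 htτ)
  have hgt : ∀ t ∈ Ioc (0 : ℝ) T, τ < ENNReal.ofReal t → ∃ s ∈ Ioo 0 t, 0 < g s :=
    fun t ht htτ => by
      obtain ⟨_, ⟨s, ⟨hs, hgs⟩, rfl⟩, hst⟩ := sInf_lt_iff.1 htτ
      exact ⟨s, ⟨hs.1, (ENNReal.ofReal_lt_ofReal_iff ht.1).1 hst⟩,
        lt_of_le_of_ne (h.slope_nonneg hg hs) (Ne.symm hgs)⟩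
  refine ⟨τ, fun t ht => ⟨hlt t ht, fun htτ => ?_⟩, ?_⟩
  · obtain ⟨s, hs, hgs⟩ := hgt t ht htτ
    have h1 := h.time_mul_slope_mono hg hs.1 hs.2.le ht.2
    have h2 : 0 < t * g t := (mul_pos hs.1 hgs).trans_le h1
    exact (pos_of_mul_pos_right h2 ht.1.le).ne'
  rintro t₀ ⟨ht₀, hne⟩
  rcases hne.lt_or_gt with hl | hl
  · have hev : ∀ᶠ s in 𝓝[{s : ℝ | s ∈ Ioc (0 : ℝ) T ∧ ENNReal.ofReal s ≠ τ}] t₀, g s = 0 := by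
      filter_upwards [self_mem_nhdsWithin, nhdsWithin_le_nhds
        (ENNReal.continuous_ofReal.continuousAt.eventually (gt_mem_nhds hl))] with s hs1 hs2
      exact hlt s hs1.1 hs2
    exact continuousWithinAt_const.congr_of_eventuallyEq hev (hlt t₀ ht₀ hl)
  have hcts : ∀ f : ℝ → ℝ, Continuous f → 0 < f t₀ →
      ∀ᶠ s in 𝓝[{s : ℝ | s ∈ Ioc (0 : ℝ) T ∧ ENNReal.ofReal s ≠ τ}] t₀, 0 < f s :=
    fun f hf h0 => nhdsWithin_le_nhds (hf.continuousAt.eventually (lt_mem_nhds h0))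
  refine tendsto_order.2 ⟨fun m hm => ?_, fun M hM => ?_⟩
  · obtain ⟨m', hm1, hm2⟩ := exists_between hm
    obtain ⟨t₁, ht₁, hlow⟩ := h.slope_lower_left hg ht₀ (hgt t₀ ht₀ hl) hm2
    filter_upwards [self_mem_nhdsWithin, hcts (fun s => s - t₁) (by fun_prop) (by linarith [ht₁.2]),
      hcts (fun s => t₀ * m' - s * m) (by fun_prop) (by nlinarith [ht₀.1])] with s hs hs1 hs2
    have := h.time_mul_slope_mono hg ht₁.1 (by linarith : t₁ ≤ s) hs.1.2
    exact lt_of_mul_lt_mul_left (by linarith : s * m < s * g s) hs.1.1.le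
  · obtain ⟨η, hη, hright⟩ := h.slope_upper_right hg ht₀ (half_pos (sub_pos.2 hM))
    filter_upwards [self_mem_nhdsWithin, hcts (fun s => t₀ + η - s) (by fun_prop) (by linarith),
      hcts (fun s => s * M - t₀ * g t₀) (by fun_prop) (by nlinarith [ht₀.1])] with s hs hs1 hs2
    rcases le_total t₀ s with hts | hts
    · have := hright s ⟨hts, by linarith⟩ hs.1.2
      linarith
    · have := h.time_mul_slope_mono hg hs.1.1 hts ht₀.2
      exact lt_of_mul_lt_mul_left (by linarith : s * g s < s * M) hs.1.1.le

end IsPosSol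

theorem exists_adjacent_zero {a b xi e : ℝ} {N₀ : Set ℝ} (hfin : N₀.Finite)
    (hxi : xi ∈ Ioo a b) (he : e = 1 ∨ e = -1) :
    ∃ L > 0, (∀ x ∈ Icc 0 L, xi + e * x ∈ Icc a b) ∧
      (xi + e * L = a ∨ xi + e * L = b ∨ xi + e * L ∈ N₀) ∧
      ∀ x ∈ Ioo 0 L, xi + e * x ∈ Ioo a b ∧ xi + e * x ∉ N₀ := by
  have he0 : e ≠ 0 := by rcases he with rfl | rfl <;> norm_num
  have hinj : Function.Injective fun x => xi + e * x := fun x y hxy =>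
    mul_left_cancel₀ he0 (add_left_cancel hxy)
  set S : Set ℝ := Ioi 0 ∩ (fun x => xi + e * x) ⁻¹' (insert a (insert b N₀)) with hS
  have hSf : S.Finite := (((hfin.insert b).insert a).preimage hinj.injOn).inter_of_right _
  have hbd : ∃ M ∈ S, ∀ x, 0 < x → x < M → xi + e * x ∈ Ioo a b := by
    rcases he with rfl | rfl
    · refine ⟨b - xi, ⟨sub_pos.2 hxi.2, Or.inr (Or.inl (by ring))⟩, fun x h1 h2 => ?_⟩
      constructor <;> linarith [hxi.1]
    · refine ⟨xi - a, ⟨sub_pos.2 hxi.1, Or.inl (by ring)⟩, fun x h1 h2 => ?_⟩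
      constructor <;> linarith [hxi.2]
  obtain ⟨M, hM, hMI⟩ := hbd
  obtain ⟨L, hL, hmin⟩ := S.exists_min_image id hSf ⟨M, hM⟩
  have hIoo : ∀ x ∈ Ioo 0 L, xi + e * x ∈ Ioo a b := fun x hx =>
    hMI x hx.1 (hx.2.trans_le (hmin M hM))
  have hL0 : 0 < L := hL.1
  refine ⟨L, hL0, fun x hx => ?_, hL.2, fun x hx => ⟨hIoo x hx, fun hN => ?_⟩⟩
  · have hcl : IsClosed ((fun x => xi + e * x) ⁻¹' Icc a b) := isClosed_Icc.preimage (by fun_prop)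
    have hsub := hcl.closure_subset_iff.2
      (fun x hx => Ioo_subset_Icc_self (hIoo x hx) : Ioo 0 L ⊆ (fun x => xi + e * x) ⁻¹' Icc a b)
    rw [closure_Ioo hL0.ne] at hsub
    exact hsub hx
  · exact absurd (hmin x ⟨hx.1, Or.inr (Or.inr hN)⟩) (not_le.2 hx.2)

theorem IsClassicalSol.const_of_adjacent {a b T : ℝ} {N₀ : Set ℝ} {u₀ : ℝ → ℝ} {u : ℝ → ℝ → ℝ}
    (hu : IsClassicalSol a b T N₀ u₀ u) (hT : 0 < T) {y : ℝ} (hy : y ∈ Icc a b)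
    (h : y = a ∨ y = b ∨ y ∈ N₀) : ∃ c, ∀ t ∈ Icc 0 T, u y t = c := by
  have hcont : ContinuousOn (fun t => u y t) (Icc 0 T) :=
    hu.cont.comp (f := fun t : ℝ => (y, t)) (by fun_prop) fun t ht => ⟨hy, ht⟩
  have hext : ∀ c, (∀ t ∈ Ioc 0 T, u y t = c) → ∀ t ∈ Icc 0 T, u y t = c := fun c hc =>
    EqOn.of_subset_closure (f := fun t => u y t) (g := fun _ => c) hc hcont continuousOn_const
      Ioc_subset_Icc_self (by rw [closure_Ioc hT.ne])
  rcases h with rfl | rfl | h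
  · exact ⟨-1, hext _ hu.bdry_a⟩
  · exact ⟨1, hext _ hu.bdry_b⟩
  · exact ⟨0, fun t ht => (hu.zero_iff y hy t ht).2 h⟩

theorem tendsto_div_of_tendsto_deriv {f f' : ℝ → ℝ} {L m : ℝ} (hL : 0 < L) (h0 : f 0 = 0)
    (hf : Continuous f) (hd : ∀ x ∈ Ioo 0 L, HasDerivAt f (f' x) x)
    (hlim : Tendsto f' (𝓝[>] 0) (𝓝 m)) : Tendsto (fun x => f x / x) (𝓝[>] 0) (𝓝 m) := by
  have hmem : Ioo 0 L ∈ 𝓝[>] (0 : ℝ) := Ioo_mem_nhdsGT hL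
  have hder : HasDerivWithinAt f m (Ici 0) 0 :=
    hasDerivWithinAt_Ici_of_tendsto_deriv
      (fun x hx => (hd x hx).differentiableAt.differentiableWithinAt)
      hf.continuousWithinAt hmem
      (hlim.congr' (by filter_upwards [hmem] with x hx using (hd x hx).deriv.symm))
  have h1 := (hasDerivWithinAt_iff_tendsto_slope' (by simp)).1 hder.Ioi_of_Ici
  refine h1.congr fun x => ?_
  rw [slope_def_field, h0, sub_zero, sub_zero]

/-- Reflecting, translating and normalizing the sign turns a classical solution, on one side of a
zero of the initial datum, into a positive solution of the normalized problem. -/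
theorem IsClassicalSol.exists_isPosSol {a b T : ℝ} {N₀ : Set ℝ} {u₀ : ℝ → ℝ} {u : ℝ → ℝ → ℝ}
    (hu : IsClassicalSol a b T N₀ u₀ u) (h₀ : InitData a b N₀ u₀) (hT : 0 < T) {xi e : ℝ}
    (hxi : xi ∈ N₀) (he : e = 1 ∨ e = -1) :
    ∃ (L c σ : ℝ) (v vxx : ℝ → ℝ → ℝ), (σ = 1 ∨ σ = -1) ∧
      IsPosSol L T c v (fun x t => σ * (pdx u (xi + e * x) t * e)) vxx := by
  obtain ⟨L, hL, hIcc, hend, hIoo⟩ := exists_adjacent_zero h₀.fin (h₀.sub hxi) he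
  obtain ⟨c, hc⟩ := hu.const_of_adjacent hT (hIcc L ⟨hL.le, le_rfl⟩) hend
  have hee : e * e = 1 := by rcases he with rfl | rfl <;> norm_num
  obtain ⟨w, hw⟩ : ∃ w : ℝ → ℝ → ℝ,
      w = fun x t => u (xi + e * max 0 (min x L)) (max 0 (min t T)) := ⟨_, rfl⟩
  have hweq : ∀ x ∈ Icc 0 L, ∀ t ∈ Icc 0 T, w x t = u (xi + e * x) t := fun x hx t ht => by
    rw [hw]
    simp only [min_eq_left hx.2, min_eq_left ht.2, max_eq_right hx.1, max_eq_right ht.1]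
  have hwc : Continuous fun p : ℝ × ℝ => w p.1 p.2 := by
    rw [hw]
    exact hu.cont.comp_continuous
      (f := fun p : ℝ × ℝ => (xi + e * max 0 (min p.1 L), max 0 (min p.2 T))) (by fun_prop)
      fun p => ⟨hIcc _ ⟨le_max_left _ _, max_le hL.le (min_le_right _ _)⟩,
        le_max_left _ _, max_le hT.le (min_le_right _ _)⟩
  have hne : ∀ x ∈ Ioo 0 L, ∀ t ∈ Icc 0 T, w x t ≠ 0 := fun x hx t ht h => by
    rw [hweq x (Ioo_subset_Icc_self hx) t ht,
      hu.zero_iff _ (Ioo_subset_Icc_self (hIoo x hx).1) t ht] at h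
    exact (hIoo x hx).2 h
  obtain ⟨σ, hσ, hpos⟩ : ∃ σ : ℝ, (σ = 1 ∨ σ = -1) ∧
      ∀ x ∈ Ioo 0 L, ∀ t ∈ Icc 0 T, 0 < σ * w x t := by
    have hmid : L / 2 ∈ Ioo 0 L := ⟨by linarith, by linarith⟩
    have hTm : T ∈ Icc 0 T := ⟨hT.le, le_rfl⟩
    obtain ⟨σ, hσ, h1⟩ : ∃ σ : ℝ, (σ = 1 ∨ σ = -1) ∧ 0 < σ * w (L / 2) T := by
      rcases (hne _ hmid T hTm).lt_or_gt with h | h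
      · exact ⟨-1, Or.inr rfl, by linarith⟩
      · exact ⟨1, Or.inl rfl, by linarith⟩
    refine ⟨σ, hσ, fun x hx t ht => ?_⟩
    by_contra! hle
    have hpre : IsPreconnected (Ioo 0 L ×ˢ Icc 0 T) := isPreconnected_Ioo.prod isPreconnected_Icc
    obtain ⟨p, hp, hp0⟩ := hpre.intermediate_value (a := (x, t)) (b := (L / 2, T))
      (f := fun p => σ * w p.1 p.2) ⟨hx, ht⟩ ⟨hmid, hTm⟩ (continuous_const.mul hwc).continuousOn
      ⟨hle, h1.le⟩
    rcases mul_eq_zero.1 hp0 with h | h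
    · rcases hσ with rfl | rfl <;> norm_num at h
    · exact hne _ hp.1 _ hp.2 h
  have hQ : ∀ x ∈ Ioo 0 L, ∀ t ∈ Ioc 0 T, (xi + e * x, t) ∈ QT a b T \ NSet N₀ T :=
    fun x hx t ht => ⟨⟨(hIoo x hx).1, ht⟩, fun h => (hIoo x hx).2 h.1⟩
  have haff : ∀ x : ℝ, HasDerivAt (fun y => xi + e * y) e x := fun x => by
    simpa using ((hasDerivAt_id x).const_mul e).const_add xi
  have hmaps : MapsTo (fun p : ℝ × ℝ => (xi + e * p.1, p.2)) (Ioo 0 L ×ˢ Ioc 0 T)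
      (QT a b T \ NSet N₀ T) := fun p hp => hQ p.1 hp.1 p.2 hp.2
  refine ⟨L, σ * c, σ, fun x t => σ * w x t, fun x t => σ * pdxx u (xi + e * x) t, hσ, ?_⟩
  exact
    { L_pos := hL
      T_pos := hT
      cont := continuous_const.mul hwc
      left := fun t ht => by
        rw [hweq 0 ⟨le_rfl, hL.le⟩ t ht, mul_zero, add_zero,
          (hu.zero_iff xi (Ioo_subset_Icc_self (h₀.sub hxi)) t ht).2 hxi, mul_zero]
      right := fun t ht => by rw [hweq L ⟨hL.le, le_rfl⟩ t ht, hc t ht]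
      pos := hpos
      hasDerivAt_x := fun x hx t ht => by
        have h1 := (hu.diff_x _ (hQ x hx t ht)).hasDerivAt.comp x (haff x)
        refine (h1.const_mul σ).congr_of_eventuallyEq ?_
        filter_upwards [isOpen_Ioo.mem_nhds hx] with y hy
        rw [hweq y (Ioo_subset_Icc_self hy) t (Ioc_subset_Icc_self ht)]
        rfl
      hasDerivAt_xx := fun x hx t ht => by
        have h1 := (hu.diff_xx _ (hQ x hx t ht)).hasDerivAt.comp x (haff x)
        have h2 := (h1.mul_const e).const_mul σ
        rw [mul_assoc, hee, mul_one] at h2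
        exact h2
      hasDerivWithinAt_t := fun x hx t ht => by
        have hxI := Ioo_subset_Icc_self hx
        have h1 := ((hu.diff_t _ (hQ x hx t ht)).hasDerivWithinAt).const_mul σ
        have h2 := hu.pde _ (hQ x hx t ht)
        have h3 : |u (xi + e * x) t| = σ * w x t := by
          have h4 := hpos x hx t (Ioc_subset_Icc_self ht)
          rw [← hweq x hxI t (Ioc_subset_Icc_self ht), ← abs_of_pos h4, abs_mul]
          rcases hσ with rfl | rfl <;> simp
        have h5 : σ * derivWithin (fun s => u (xi + e * x) s) (Iic T) t =
            σ * w x t * (σ * pdxx u (xi + e * x) t + 1 - σ * w x t) := by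
          change σ * pdtW T u (xi + e * x) t = _
          simp only at h2
          rw [h2, h3, ← hweq x hxI t (Ioc_subset_Icc_self ht)]
          ring
        simp only at h1
        rw [h5] at h1
        refine h1.congr_of_eventuallyEq ?_ (by rw [hweq x hxI t (Ioc_subset_Icc_self ht)])
        filter_upwards [self_mem_nhdsWithin, nhdsWithin_le_nhds (Ioi_mem_nhds ht.1)] with s hs1 hs2
        rw [hweq x hxI s ⟨le_of_lt hs2, hs1⟩]
      cont_x := continuousOn_const.mul
        ((hu.cont_x.comp (by fun_prop) hmaps).mul continuousOn_const)
      cont_xx := continuousOn_const.mul (hu.cont_xx.comp (by fun_prop) hmaps) }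

theorem IsClassicalSol.exists_waiting_time {a b T : ℝ} {N₀ : Set ℝ} {u₀ : ℝ → ℝ}
    {u : ℝ → ℝ → ℝ} (hu : IsClassicalSol a b T N₀ u₀ u) (h₀ : InitData a b N₀ u₀) (hT : 0 < T)
    {xi e : ℝ} (hxi : xi ∈ N₀) (he : e = 1 ∨ e = -1) {ux : ℝ → ℝ}
    (hux : ∀ t ∈ Ioc 0 T, Tendsto (fun x => pdx u (xi + e * x) t) (𝓝[>] 0) (𝓝 (ux t))) :
    ∃ τ : ENNReal,
      (∀ t ∈ Ioc (0 : ℝ) T,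
        (ENNReal.ofReal t < τ → ux t = 0) ∧ (τ < ENNReal.ofReal t → ux t ≠ 0)) ∧
      ContinuousOn ux {s : ℝ | s ∈ Ioc (0 : ℝ) T ∧ ENNReal.ofReal s ≠ τ} := by
  obtain ⟨L, c, σ, v, vxx, hσ, hv⟩ := hu.exists_isPosSol h₀ hT hxi he
  obtain ⟨τ, hτ, hcont⟩ := hv.exists_waiting_time (g := fun t => σ * (ux t * e)) fun t ht =>
    tendsto_div_of_tendsto_deriv hv.L_pos (hv.left t (Ioc_subset_Icc_self ht))
      (hv.cont.comp (by fun_prop : Continuous fun x : ℝ => (x, t)))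
      (fun x hx => hv.hasDerivAt_x x hx t ht) (((hux t ht).mul_const e).const_mul σ)
  have he0 : e ≠ 0 := by rcases he with rfl | rfl <;> norm_num
  have hσ0 : σ ≠ 0 := by rcases hσ with rfl | rfl <;> norm_num
  refine ⟨τ, fun t ht => ⟨fun h => ?_, fun h h0 => (hτ t ht).2 h (by simp [h0])⟩, ?_⟩
  · have := (hτ t ht).1 h
    simpa [he0, hσ0] using this
  · refine (hcont.const_smul (σ * e)⁻¹).congr fun t _ => ?_
    change ux t = (σ * e)⁻¹ * (σ * (ux t * e))
    field_simp

/-- Theorem 3.2(ii): for each zero `x_i ∈ N₀` there exist `τ_i^± ∈ [0,∞]` such that the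
one-sided derivative `u_x(x_i^±, t)` vanishes for `0 < t < τ_i^±` and is nonzero for
`t > τ_i^±`; moreover `t ↦ u_x(x_i^±, t)` is continuous on `(0,T] ∖ {τ_i^±}`. -/
theorem stmt5 (a b T : ℝ) (hab : a < b) (hT : 0 < T)
    (N₀ : Set ℝ) (u₀ : ℝ → ℝ) (h₀ : InitData a b N₀ u₀)
    (u : ℝ → ℝ → ℝ) (hu : IsClassicalSol a b T N₀ u₀ u)
    (xi : ℝ) (hxi : xi ∈ N₀) (uxp uxm : ℝ → ℝ)
    (huxp : ∀ t ∈ Set.Ioc (0:ℝ) T, Tendsto (fun y => pdx u y t) (𝓝[>] xi) (𝓝 (uxp t)))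
    (huxm : ∀ t ∈ Set.Ioc (0:ℝ) T, Tendsto (fun y => pdx u y t) (𝓝[<] xi) (𝓝 (uxm t))) :
    (∃ τp : ENNReal,
      (∀ t ∈ Set.Ioc (0:ℝ) T,
        (ENNReal.ofReal t < τp → uxp t = 0) ∧ (τp < ENNReal.ofReal t → uxp t ≠ 0)) ∧
      ContinuousOn uxp {s : ℝ | s ∈ Set.Ioc (0:ℝ) T ∧ ENNReal.ofReal s ≠ τp}) ∧
    (∃ τm : ENNReal,
      (∀ t ∈ Set.Ioc (0:ℝ) T,
        (ENNReal.ofReal t < τm → uxm t = 0) ∧ (τm < ENNReal.ofReal t → uxm t ≠ 0)) ∧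
      ContinuousOn uxm {s : ℝ | s ∈ Set.Ioc (0:ℝ) T ∧ ENNReal.ofReal s ≠ τm}) := by
  refine ⟨hu.exists_waiting_time h₀ hT hxi (e := 1) (Or.inl rfl) fun t ht => ?_,
    hu.exists_waiting_time h₀ hT hxi (e := -1) (Or.inr rfl) fun t ht => ?_⟩
  · refine (huxp t ht).comp (tendsto_nhdsWithin_iff.2 ⟨?_, ?_⟩)
    · have h : Tendsto (fun x : ℝ => xi + 1 * x) (𝓝 0) (𝓝 (xi + 1 * 0)) :=
        (by fun_prop : Continuous fun x : ℝ => xi + 1 * x).tendsto 0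
      rw [mul_zero, add_zero] at h
      exact h.mono_left nhdsWithin_le_nhds
    · filter_upwards [self_mem_nhdsWithin] with x hx
      have : (0 : ℝ) < x := hx
      exact mem_Ioi.2 (by linarith)
  · refine (huxm t ht).comp (tendsto_nhdsWithin_iff.2 ⟨?_, ?_⟩)
    · have h : Tendsto (fun x : ℝ => xi + -1 * x) (𝓝 0) (𝓝 (xi + -1 * 0)) :=
        (by fun_prop : Continuous fun x : ℝ => xi + -1 * x).tendsto 0
      rw [mul_zero, add_zero] at h
      exact h.mono_left nhdsWithin_le_nhds
    · filter_upwards [self_mem_nhdsWithin] with x hx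
      have : (0 : ℝ) < x := hx
      exact mem_Iio.2 (by linarith)
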